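/- The Boolean conjunctive query T() :- R(y_1,y_2) ∧ R(y_2,y_3) ∧ R(y_3,y_4) ∧ R(y_4,y_5) (over a schema with one binary relation R) is not uniquely characterized, with respect to the class of Boolean acyclic connected conjunctive queries, by any finite set of acyclic positive and negative examples. -/

import Mathlib

/-- A finite relational structure over a schema `S` (with arity function `ar`)
with `k` distinguished elements. -/
structure PStruct (S : Type) (ar : S → ℕ) (k : ℕ) : Type 1 where
  dom : Type
  finite : Finite dom
  facts : ∀ R : S, Set (Fin (ar R) → dom)
  dist : Fin k → dom

attribute [instance] PStruct.finite

namespace PStruct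

variable {S : Type} {ar : S → ℕ} {k : ℕ}

/-- `h` is a homomorphism from `A` to `B`: it preserves all facts and maps
distinguished elements to corresponding distinguished elements. -/
def IsHom (A B : PStruct S ar k) (h : A.dom → B.dom) : Prop :=
  (∀ (R : S) (t : Fin (ar R) → A.dom), t ∈ A.facts R → (fun i => h (t i)) ∈ B.facts R) ∧
  ∀ i : Fin k, h (A.dist i) = B.dist i

/-- `(A,𝐚) → (B,𝐛)`: a homomorphism exists. -/
def HomTo (A B : PStruct S ar k) : Prop := ∃ h, IsHom A B h

/-- Homomorphic equivalence. -/
def HomEquiv (A B : PStruct S ar k) : Prop := HomTo A B ∧ HomTo B A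

/-- Direct product of two structures with distinguished elements. -/
def prod (A B : PStruct S ar k) : PStruct S ar k where
  dom := A.dom × B.dom
  finite := inferInstance
  facts R := {t | (fun i => (t i).1) ∈ A.facts R ∧ (fun i => (t i).2) ∈ B.facts R}
  dist i := (A.dist i, B.dist i)

/-- The facts of a structure, as a type. -/
def Fact (A : PStruct S ar k) : Type := Σ R : S, {t : Fin (ar R) → A.dom // t ∈ A.facts R}

/-- Occurrences of elements in facts: a fact together with a position in it. -/
def Occ (A : PStruct S ar k) : Type :=
  Σ R : S, {t : Fin (ar R) → A.dom // t ∈ A.facts R} × Fin (ar R)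

def Occ.fact {A : PStruct S ar k} (o : Occ A) : Fact A := ⟨o.1, o.2.1⟩

def Occ.elem {A : PStruct S ar k} (o : Occ A) : A.dom := o.2.1.1 o.2.2

/-- Vertices of the (subdivided) incidence graph: elements, occurrences, and facts.
Each occurrence vertex subdivides one edge of the bipartite incidence multigraph,
so that cycles (resp. connectivity) of the incidence multigraph correspond exactly to
cycles (resp. connectivity) of this simple graph. -/
def IncV (A : PStruct S ar k) : Type := A.dom ⊕ (Occ A ⊕ Fact A)

/-- The incidence graph of a structure, as a simple graph (with each
element-occurrence-in-a-fact edge of the incidence multigraph subdivided). -/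
def incGraph (A : PStruct S ar k) : SimpleGraph (IncV A) where
  Adj v w := ∃ o : Occ A,
    (v = Sum.inl o.elem ∧ w = Sum.inr (Sum.inl o)) ∨
    (w = Sum.inl o.elem ∧ v = Sum.inr (Sum.inl o)) ∨
    (v = Sum.inr (Sum.inl o) ∧ w = Sum.inr (Sum.inr o.fact)) ∨
    (w = Sum.inr (Sum.inl o) ∧ v = Sum.inr (Sum.inr o.fact))
  symm := by
    refine ⟨?_⟩
    rintro v w ⟨o, h⟩
    exact ⟨o, by tauto⟩
  loopless := by
    refine ⟨?_⟩
    rintro v ⟨o, (⟨h1, h2⟩ | ⟨h1, h2⟩ | ⟨h1, h2⟩ | ⟨h1, h2⟩)⟩ <;> rw [h1] at h2 <;>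
      cases h2

/-- A structure is acyclic if its incidence graph is acyclic (Berge acyclicity). -/
def Acyclic (A : PStruct S ar k) : Prop := (incGraph A).IsAcyclic

/-- A structure is c-acyclic if every cycle of its incidence graph passes through
a distinguished element. -/
def CAcyclic (A : PStruct S ar k) : Prop :=
  ∀ (v : IncV A) (c : (incGraph A).Walk v v), c.IsCycle →
    ∃ i : Fin k, Sum.inl (A.dist i) ∈ c.support

/-- A structure is c-connected if every connected component of its incidence graph
contains a distinguished element. -/
def CConnected (A : PStruct S ar k) : Prop :=
  ∀ v : IncV A, ∃ i : Fin k, (incGraph A).Reachable (Sum.inl (A.dist i)) v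

/-- The incidence graph is connected. -/
def IncConnected (A : PStruct S ar k) : Prop := (incGraph A).Connected

/-- The fact graph: vertices are facts, with an edge between distinct facts that
share a non-distinguished element. -/
def factGraph (A : PStruct S ar k) : SimpleGraph (Fact A) where
  Adj f g := f ≠ g ∧ ∃ b : A.dom, (∀ i, b ≠ A.dist i) ∧ (∃ j, f.2.1 j = b) ∧ (∃ j, g.2.1 j = b)
  symm := by
    refine ⟨?_⟩
    rintro f g ⟨hne, b, h1, h2, h3⟩
    exact ⟨hne.symm, b, h1, h3, h2⟩
  loopless := by refine ⟨?_⟩; rintro f ⟨hne, -⟩; exact hne rfl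

/-- A structure is fg-connected if its fact graph is connected. -/
def FgConnected (A : PStruct S ar k) : Prop := (factGraph A).Connected

/-- A structure is a core if it admits no homomorphism to a proper substructure,
i.e. every endomorphism is surjective on elements and on facts. -/
def IsCore (A : PStruct S ar k) : Prop :=
  ∀ h : A.dom → A.dom, IsHom A A h →
    Function.Surjective h ∧
    ∀ (R : S) (t : Fin (ar R) → A.dom), t ∈ A.facts R →
      ∃ s ∈ A.facts R, (fun i => h (s i)) = t

/-- Unique Names Property: the distinguished elements are pairwise distinct. -/
def UNP (A : PStruct S ar k) : Prop := Function.Injective A.dist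

/-- A structure is safe if every distinguished element occurs in at least one fact. -/
def Safe (A : PStruct S ar k) : Prop :=
  ∀ i : Fin k, ∃ (R : S) (t : Fin (ar R) → A.dom), t ∈ A.facts R ∧ ∃ j, t j = A.dist i

/-- A structure is (the canonical structure of) a conjunctive query iff every element
occurs in at least one fact (in particular it is safe). -/
def IsCQ (A : PStruct S ar k) : Prop :=
  ∀ x : A.dom, ∃ (R : S) (t : Fin (ar R) → A.dom), t ∈ A.facts R ∧ ∃ j, t j = x

/-- The size of a structure: its number of facts. -/
noncomputable def size (A : PStruct S ar k) : ℕ := Nat.card (Fact A)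

/-- The total size of a set of structures: the sum of (size + 1) over its members. -/
noncomputable def totalSize (F : Set (PStruct S ar k)) : ℕ := ∑ᶠ B ∈ F, (size B + 1)

/-- `F` is a frontier for `A` with respect to the class `C`. -/
def IsFrontier (C : Set (PStruct S ar k)) (A : PStruct S ar k)
    (F : Set (PStruct S ar k)) : Prop :=
  F.Finite ∧
  (∀ B ∈ F, HomTo B A) ∧
  (∀ B ∈ F, ¬ HomTo A B) ∧
  ∀ C' ∈ C, HomTo C' A → ¬ HomTo A C' → ∃ B ∈ F, HomTo C' B

/-- `D` is a finite duality for `A` with respect to the class `C`. -/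
def IsDuality (C : Set (PStruct S ar k)) (A : PStruct S ar k)
    (D : Set (PStruct S ar k)) : Prop :=
  D.Finite ∧ ∀ C' ∈ C, (HomTo A C' ↔ ∀ B ∈ D, ¬ HomTo C' B)

/-- A conjunctive query (given by its canonical structure `Q`) fits the example sets
`(E⁺, E⁻)`: every example in `E⁺` is positive and every example in `E⁻` is negative.
(By Chandra–Merlin, `(A,𝐚)` is a positive example for `Q` iff `Q → (A,𝐚)`.) -/
def Fits (Q : PStruct S ar k) (Ep Em : Set (PStruct S ar k)) : Prop :=
  (∀ E ∈ Ep, HomTo Q E) ∧ (∀ E ∈ Em, ¬ HomTo Q E)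

/-- `(E⁺, E⁻)` uniquely characterizes the CQ `Q` with respect to the class `C` of CQs
(all represented by their canonical structures): `Q` fits, and every member of `C`
that fits is logically equivalent (i.e. homomorphically equivalent) to `Q`. -/
def UniquelyCharacterizes (Ep Em : Set (PStruct S ar k)) (Q : PStruct S ar k)
    (C : Set (PStruct S ar k)) : Prop :=
  Fits Q Ep Em ∧ ∀ Q' ∈ C, Fits Q' Ep Em → HomEquiv Q Q'

end PStruct

open PStruct

/-- The Boolean path query `T() :- R(y₁,y₂) ∧ R(y₂,y₃) ∧ R(y₃,y₄) ∧ R(y₄,y₅)`,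
represented by its canonical structure (with `yᵢ = i - 1 : Fin 5`),
over the schema with one binary relation. -/
def Tq : PStruct Unit (fun _ => 2) 0 where
  dom := Fin 5
  finite := inferInstance
  facts _ := {t | (t 0 = 0 ∧ t 1 = 1) ∨ (t 0 = 1 ∧ t 1 = 2) ∨
                  (t 0 = 2 ∧ t 1 = 3) ∨ (t 0 = 3 ∧ t 1 = 4)}
  dist := Fin.elim0



abbrev BStruct := PStruct Unit (fun _ => 2) 0

/-- The binary relation of a structure. -/
def BRel (E : BStruct) (x y : E.dom) : Prop := (![x, y] : Fin 2 → E.dom) ∈ E.facts ()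

theorem rel_of_mem {E : BStruct} {t : Fin 2 → E.dom} (h : t ∈ E.facts ()) :
    BRel E (t 0) (t 1) := by
  have : (![t 0, t 1] : Fin 2 → E.dom) = t := by
    ext i; fin_cases i <;> rfl
  unfold BRel; rw [this]; exact h

theorem isHom_of_rel {A B : BStruct} {h : A.dom → B.dom}
    (H : ∀ x y, BRel A x y → BRel B (h x) (h y)) : IsHom A B h := by
  refine ⟨?_, fun i => i.elim0⟩
  rintro ⟨⟩ t ht
  have h1 := H _ _ (rel_of_mem ht)
  have : (![h (t 0), h (t 1)] : Fin 2 → B.dom) = fun i => h (t i) := by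
    ext i; fin_cases i <;> rfl
  unfold BRel at h1; rw [this] at h1; exact h1

theorem rel_of_isHom {A B : BStruct} {h : A.dom → B.dom} (H : IsHom A B h) {x y : A.dom}
    (hxy : BRel A x y) : BRel B (h x) (h y) := rel_of_mem (H.1 () _ hxy)

theorem rel_Tq (x y : Fin 5) : BRel Tq x y ↔ x.val + 1 = y.val := by
  unfold BRel
  change ((x = 0 ∧ y = 1) ∨ (x = 1 ∧ y = 2) ∨ (x = 2 ∧ y = 3) ∨ (x = 3 ∧ y = 4)) ↔ _
  revert x y; decide

theorem Tq_hom {E : BStruct} {a b c d e : E.dom} (h1 : BRel E a b) (h2 : BRel E b c)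
    (h3 : BRel E c d) (h4 : BRel E d e) : HomTo Tq E := by
  refine ⟨(![a, b, c, d, e] : Fin 5 → E.dom), isHom_of_rel ?_⟩
  intro x y hxy
  have h := (rel_Tq x y).1 hxy
  change Fin 5 at x y
  fin_cases x <;> fin_cases y <;> first | (exfalso; revert h; decide) | assumption

theorem of_Tq_hom {E : BStruct} (H : HomTo Tq E) :
    ∃ a b c d e, BRel E a b ∧ BRel E b c ∧ BRel E c d ∧ BRel E d e := by
  obtain ⟨h, hh⟩ := H
  exact ⟨h (0 : Fin 5), h (1 : Fin 5), h (2 : Fin 5), h (3 : Fin 5), h (4 : Fin 5),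
    rel_of_isHom hh ((rel_Tq 0 1).2 rfl), rel_of_isHom hh ((rel_Tq 1 2).2 rfl),
    rel_of_isHom hh ((rel_Tq 2 3).2 rfl), rel_of_isHom hh ((rel_Tq 3 4).2 rfl)⟩

/-! ### Graph lemmas -/

/-- A nonbacktracking walk in an acyclic graph is a path. -/
theorem exists_path {V : Type} {G : SimpleGraph V} (hG : G.IsAcyclic) (w : ℕ → V) (L : ℕ)
    (hadj : ∀ k < L, G.Adj (w k) (w (k + 1))) (hne : ∀ k, k + 2 ≤ L → w k ≠ w (k + 2)) :
    ∀ n ≤ L, ∃ p : G.Walk (w n) (w 0), p.IsPath ∧ p.length = n ∧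
      ∀ k, n = k + 1 → p.snd = w k := by
  intro n
  induction n with
  | zero => intro _; exact ⟨.nil, by simp, rfl, by simp⟩
  | succ n ih =>
    intro hn
    obtain ⟨p, hp, hl, hs⟩ := ih (by omega)
    have ha := (hadj n (by omega)).symm
    refine ⟨.cons ha p, ?_, by simp [hl], ?_⟩
    · rw [SimpleGraph.Walk.cons_isPath_iff]
      refine ⟨hp, fun hmem => ?_⟩
      have h2 := hG.eq_snd_of_adj_start hp ha.symm hmem
      rcases n with _ | k
      · have : p.Nil := SimpleGraph.Walk.length_eq_zero_iff.1 hl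
        have h3 := SimpleGraph.Walk.nil_iff_support_eq.1 this
        rw [h3] at hmem
        simp at hmem
        rw [hmem] at ha
        exact G.loopless.irrefl _ ha
      · rw [hs k rfl] at h2
        exact hne k (by omega) h2.symm
    · intro k hk
      obtain rfl : n = k := by omega
      simp

theorem acyclic_of_rank {V : Type} {G : SimpleGraph V} (r : V → ℕ)
    (H : ∀ v a b, G.Adj v a → G.Adj v b → r a ≤ r v → r b ≤ r v → a = b) : G.IsAcyclic := by
  classical
  intro v c hc
  obtain ⟨u, hu, hmax⟩ := Finset.exists_max_image c.support.toFinset r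
    ⟨v, by simp⟩
  have hu' : u ∈ c.support := by simpa using hu
  have hc' := (SimpleGraph.Walk.isCycle_rotate hu').2 hc
  have key : ∀ x ∈ (c.rotate _ hu').support, r x ≤ r u := by
    intro x hx
    apply hmax
    simpa using (SimpleGraph.Walk.mem_support_rotate_iff c u hu').1 hx
  apply hc'.snd_ne_penultimate
  refine H u _ _ ((c.rotate _ hu').adj_snd hc'.not_nil)
    ((c.rotate _ hu').adj_penultimate hc'.not_nil).symm (key _ ?_) (key _ ?_)
  · simp
  · simp

/-- The Gaifman graph. -/
def gai (E : BStruct) : SimpleGraph E.dom where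
  Adj x y := x ≠ y ∧ (BRel E x y ∨ BRel E y x)
  symm := ⟨fun _ _ h => ⟨h.1.symm, h.2.symm⟩⟩
  loopless := ⟨fun _ h => h.1 rfl⟩

def mkFact {E : BStruct} (t : Fin 2 → E.dom) (h : t ∈ E.facts ()) : Fact E := ⟨(), ⟨t, h⟩⟩
def mkOcc {E : BStruct} (t : Fin 2 → E.dom) (h : t ∈ E.facts ()) (i : Fin 2) : Occ E :=
  ⟨(), ⟨t, h⟩, i⟩

def vE {E : BStruct} (x : E.dom) : IncV E := Sum.inl x
def vO {E : BStruct} (t : Fin 2 → E.dom) (h : t ∈ E.facts ()) (i : Fin 2) : IncV E :=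
  Sum.inr (Sum.inl (mkOcc t h i))
def vF {E : BStruct} (t : Fin 2 → E.dom) (h : t ∈ E.facts ()) : IncV E :=
  Sum.inr (Sum.inr (mkFact t h))

theorem adjEO {E : BStruct} (t : Fin 2 → E.dom) (h : t ∈ E.facts ()) (i : Fin 2) :
    (incGraph E).Adj (vE (t i)) (vO t h i) := ⟨mkOcc t h i, Or.inl ⟨rfl, rfl⟩⟩

theorem adjOF {E : BStruct} (t : Fin 2 → E.dom) (h : t ∈ E.facts ()) (i : Fin 2) :
    (incGraph E).Adj (vO t h i) (vF t h) := ⟨mkOcc t h i, Or.inr (Or.inr (Or.inl ⟨rfl, rfl⟩))⟩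

theorem vO_inj {E : BStruct} {t s : Fin 2 → E.dom} {h : t ∈ E.facts ()} {h' : s ∈ E.facts ()}
    {i j : Fin 2} (e : vO t h i = vO s h' j) : t = s ∧ i = j := by
  unfold vO mkOcc at e
  have e1 := Sum.inl.inj (Sum.inr.inj e)
  have e2 := eq_of_heq (Sigma.mk.inj e1).2
  exact ⟨congrArg (fun z => z.1.1) e2, congrArg (fun z => z.2) e2⟩

theorem gai_acyclic {E : BStruct} (hE : Acyclic E) : (gai E).IsAcyclic := by
  have main : ∀ x y, BRel E x y → x ≠ y →
      ¬ ((gai E).deleteEdges {s(x, y)}).Reachable x y := by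
    intro x y hxy hne hr
    have hb := SimpleGraph.isAcyclic_iff_forall_adj_isBridge.1 hE (adjOF _ hxy 0)
    rw [SimpleGraph.isBridge_iff] at hb
    set D := (incGraph E).deleteEdges {s(vO _ hxy 0, vF _ hxy)} with hD
    have aEO : ∀ t h i, D.Adj (vE (t i)) (vO t h i) := by
      intro t h i
      rw [hD, SimpleGraph.deleteEdges_adj]
      refine ⟨adjEO t h i, ?_⟩
      intro hm
      rw [Set.mem_singleton_iff, Sym2.eq_iff] at hm
      rcases hm with ⟨hm, -⟩ | ⟨hm, -⟩ <;> cases hm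
    have aOF : ∀ t h i, (t ≠ ![x, y] ∨ i ≠ 0) → D.Adj (vO t h i) (vF t h) := by
      intro t h i hh
      rw [hD, SimpleGraph.deleteEdges_adj]
      refine ⟨adjOF t h i, ?_⟩
      intro hm
      rw [Set.mem_singleton_iff, Sym2.eq_iff] at hm
      rcases hm with ⟨hm, -⟩ | ⟨hm, -⟩
      · have := vO_inj hm
        tauto
      · cases hm
    have step : ∀ t (h : t ∈ E.facts ()), t ≠ ![x, y] → D.Reachable (vE (t 0)) (vE (t 1)) := by
      intro t h ht
      exact (((aEO t h 0).reachable.trans (aOF t h 0 (Or.inl ht)).reachable).trans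
        (aOF t h 1 (Or.inl ht)).symm.reachable).trans (aEO t h 1).symm.reachable
    have all : ∀ a b, ((gai E).deleteEdges {s(x, y)}).Reachable a b →
        D.Reachable (vE a) (vE b) := by
      rintro a b ⟨p⟩
      induction p with
      | nil => rfl
      | cons h p ih =>
        rename_i u v w
        refine SimpleGraph.Reachable.trans ?_ ih
        rw [SimpleGraph.deleteEdges_adj] at h
        obtain ⟨⟨hn, h1 | h1⟩, h2⟩ := h
        · refine step ![u, v] h1 ?_
          intro e
          apply h2
          have e0 := congrFun e 0
          have e1 := congrFun e 1
          simp at e0 e1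
          simp [e0, e1]
        · refine (step ![v, u] h1 ?_).symm
          intro e
          apply h2
          have e0 := congrFun e 0
          have e1 := congrFun e 1
          simp at e0 e1
          simp [e0, e1]
    apply hb
    exact (((aEO _ hxy 0).symm.reachable.trans (all _ _ hr)).trans
      (aEO _ hxy 1).reachable).trans (aOF _ hxy 1 (Or.inr (by decide))).reachable
  rw [SimpleGraph.isAcyclic_iff_forall_adj_isBridge]
  rintro x y ⟨hne, h | h⟩
  · rw [SimpleGraph.isBridge_iff]; exact main x y h hne
  · rw [Sym2.eq_swap, SimpleGraph.isBridge_iff]; exact main y x h hne.symm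

/-! ### The queries -/

/-- Parent function of the tree. -/
def par (n : ℕ) : ℕ :=
  if n % 8 = 0 then n - 5 else if n % 8 = 4 ∨ n % 8 = 6 then n - 3 else n - 1

/-- Orientation of the edge between `n` and its parent. -/
def up (n : ℕ) : Prop := n % 8 = 0 ∨ n % 8 = 3 ∨ n % 8 = 6 ∨ n % 8 = 7

/-- Edges from `x` to `y`. -/
def edg (x y : ℕ) : Prop := (1 ≤ y ∧ up y ∧ x = par y) ∨ (1 ≤ x ∧ ¬ up x ∧ y = par x)

theorem par_lt {n : ℕ} (h : 1 ≤ n) : par n < n := by unfold par; split_ifs <;> omega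

def QN (N : ℕ) : BStruct where
  dom := Fin N
  finite := inferInstance
  facts _ := {t | edg (t 0).val (t 1).val}
  dist := Fin.elim0

theorem rel_QN {N : ℕ} (x y : Fin N) : BRel (QN N) x y ↔ edg x.val y.val := Iff.rfl

theorem edg_cases {x y : ℕ} (h : edg x y) :
    (x % 8 = 3 ∧ y % 8 = 0) ∨ (x % 8 = 2 ∧ y % 8 = 3) ∨ (x % 8 = 3 ∧ y % 8 = 6) ∨
    (x % 8 = 6 ∧ y % 8 = 7) ∨ (x % 8 = 1 ∧ y % 8 = 0) ∨ (x % 8 = 2 ∧ y % 8 = 1) ∨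
    (x % 8 = 4 ∧ y % 8 = 1) ∨ (x % 8 = 5 ∧ y % 8 = 4) := by
  rcases h with ⟨h1, h2, h3⟩ | ⟨h1, h2, h3⟩
  · rcases h2 with h2 | h2 | h2 | h2 <;> simp [par, h2] at h3
    · exact Or.inl (by omega)
    · exact Or.inr (Or.inl (by omega))
    · exact Or.inr (Or.inr (Or.inl (by omega)))
    · exact Or.inr (Or.inr (Or.inr (Or.inl (by omega))))
  · have hr : x % 8 = 1 ∨ x % 8 = 2 ∨ x % 8 = 4 ∨ x % 8 = 5 := by unfold up at h2; omega
    rcases hr with h2 | h2 | h2 | h2 <;> simp [par, h2] at h3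
    · exact Or.inr (Or.inr (Or.inr (Or.inr (Or.inl (by omega)))))
    · exact Or.inr (Or.inr (Or.inr (Or.inr (Or.inr (Or.inl (by omega))))))
    · exact Or.inr (Or.inr (Or.inr (Or.inr (Or.inr (Or.inr (Or.inl (by omega)))))))
    · exact Or.inr (Or.inr (Or.inr (Or.inr (Or.inr (Or.inr (Or.inr (by omega)))))))

theorem QN_hom (N : ℕ) : HomTo (QN N) Tq := by
  let lv : ℕ → Fin 5 := fun n =>
    if n % 8 = 0 then 3 else if n % 8 = 1 then 2 else if n % 8 = 2 then 1 else
    if n % 8 = 3 then 2 else if n % 8 = 4 then 1 else if n % 8 = 5 then 0 else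
    if n % 8 = 6 then 3 else 4
  refine ⟨fun x : Fin N => lv x.val, isHom_of_rel ?_⟩
  intro x y hxy
  have h : edg (x : Fin N).val (y : Fin N).val := hxy
  refine (rel_Tq _ _).2 ?_
  generalize (x : Fin N).val = a at *
  generalize (y : Fin N).val = b at *
  rcases edg_cases h with h | h | h | h | h | h | h | h <;> simp [lv, h.1, h.2]

theorem QN_nhom (N : ℕ) : ¬ HomTo Tq (QN N) := by
  intro H
  obtain ⟨a, b, c, d, e, h1, h2, h3, h4⟩ := of_Tq_hom H
  let ps : ℕ → ℕ := fun n =>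
    if n % 8 = 0 then 3 else if n % 8 = 1 then 2 else if n % 8 = 2 then 0 else
    if n % 8 = 3 then 1 else if n % 8 = 4 then 1 else if n % 8 = 5 then 0 else
    if n % 8 = 6 then 2 else 3
  have key : ∀ x y, edg x y → ps x < ps y := by
    intro a b h
    rcases edg_cases h with h | h | h | h | h | h | h | h <;> simp [ps, h.1, h.2]
  have k1 := key (a : Fin N).val (b : Fin N).val h1
  have k2 := key (b : Fin N).val (c : Fin N).val h2
  have k3 := key (c : Fin N).val (d : Fin N).val h3
  have k4 := key (d : Fin N).val (e : Fin N).val h4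
  have : ps (e : Fin N).val ≤ 3 := by simp only [ps]; split_ifs <;> omega
  omega

theorem edg_ne {x y : ℕ} (h : edg x y) : x ≠ y := by
  rcases h with ⟨h1, -, h3⟩ | ⟨h1, -, h3⟩ <;> have := par_lt h1 <;> omega

theorem edg_max {x y : ℕ} (h : edg x y) : 1 ≤ max x y ∧
    (up (max x y) ∧ y = max x y ∧ x = par (max x y) ∨
      ¬ up (max x y) ∧ x = max x y ∧ y = par (max x y)) := by
  rcases h with ⟨h1, h2, h3⟩ | ⟨h1, h2, h3⟩
  · have := par_lt h1
    have e : max x y = y := by omega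
    rw [e]; exact ⟨h1, Or.inl ⟨h2, rfl, h3⟩⟩
  · have := par_lt h1
    have e : max x y = x := by omega
    rw [e]; exact ⟨h1, Or.inr ⟨h2, rfl, h3⟩⟩

theorem QN_fact_unique {N : ℕ} {t s : Fin 2 → Fin N} (ht : edg (t 0).val (t 1).val)
    (hs : edg (s 0).val (s 1).val)
    (h : max (t 0).val (t 1).val = max (s 0).val (s 1).val) : t = s := by
  have h1 := edg_max ht
  have h2 := edg_max hs
  rw [← h] at h2
  have e0 : (t 0).val = (s 0).val := by grind
  have e1 : (t 1).val = (s 1).val := by grind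
  ext i
  fin_cases i
  · exact e0
  · exact e1

def rk (N : ℕ) : IncV (QN N) → ℕ
  | Sum.inl x => 4 * (x : Fin N).val
  | Sum.inr (Sum.inl ⟨_, t, i⟩) =>
      let m := max (t.1 (0 : Fin 2) : Fin N).val (t.1 (1 : Fin 2) : Fin N).val
      if (t.1 i : Fin N).val = m then 4 * m - 1 else 4 * m - 3
  | Sum.inr (Sum.inr ⟨_, t⟩) =>
      4 * max (t.1 (0 : Fin 2) : Fin N).val (t.1 (1 : Fin 2) : Fin N).val - 2

theorem IncV_cases {E : BStruct} (v : IncV E) :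
    (∃ x, v = vE x) ∨ (∃ t h i, v = vO t h i) ∨ ∃ t h, v = vF t h := by
  rcases v with x | ⟨⟨⟩, ⟨t, h⟩, i⟩ | ⟨⟨⟩, t, h⟩
  · exact Or.inl ⟨x, rfl⟩
  · exact Or.inr (Or.inl ⟨t, h, i, rfl⟩)
  · exact Or.inr (Or.inr ⟨t, h, rfl⟩)

theorem adj_vE {E : BStruct} {x : E.dom} {a : IncV E} (h : (incGraph E).Adj (vE x) a) :
    ∃ t ht i, t i = x ∧ a = vO t ht i := by
  obtain ⟨⟨⟨⟩, ⟨t, ht⟩, i⟩, ⟨h1, h2⟩ | ⟨h1, h2⟩ | ⟨h1, h2⟩ | ⟨h1, h2⟩⟩ := h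
  · exact ⟨t, ht, i, (Sum.inl.inj h1).symm, h2⟩
  all_goals simp [vE] at h2 h1

theorem adj_vO {E : BStruct} {t : Fin 2 → E.dom} {ht : t ∈ E.facts ()} {i : Fin 2}
    {a : IncV E} (h : (incGraph E).Adj (vO t ht i) a) : a = vE (t i) ∨ a = vF t ht := by
  obtain ⟨⟨⟨⟩, ⟨s, hs⟩, j⟩, ⟨h1, h2⟩ | ⟨h1, h2⟩ | ⟨h1, h2⟩ | ⟨h1, h2⟩⟩ := h
  · cases h1
  · obtain ⟨rfl, rfl⟩ := vO_inj (h' := hs) h2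
    exact Or.inl h1
  · obtain ⟨rfl, rfl⟩ := vO_inj (h' := hs) h1
    exact Or.inr h2
  · cases h2

theorem adj_vF {E : BStruct} {t : Fin 2 → E.dom} {ht : t ∈ E.facts ()}
    {a : IncV E} (h : (incGraph E).Adj (vF t ht) a) : ∃ i, a = vO t ht i := by
  obtain ⟨⟨⟨⟩, ⟨s, hs⟩, j⟩, ⟨h1, h2⟩ | ⟨h1, h2⟩ | ⟨h1, h2⟩ | ⟨h1, h2⟩⟩ := h
  · cases h1
  · cases h2
  · cases h1
  · have e := Sum.inr.inj (Sum.inr.inj h2)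
    have e2 := congrArg Subtype.val (eq_of_heq (Sigma.mk.inj e).2)
    have e3 : t = s := e2
    subst e3
    exact ⟨j, h1⟩

theorem QN_acyclic (N : ℕ) : Acyclic (QN N) := by
  refine acyclic_of_rank (rk N) ?_
  have rE : ∀ x : Fin N, rk N (vE (E := QN N) x) = 4 * x.val := fun _ => rfl
  have rO : ∀ (t : Fin 2 → Fin N) (h) (i : Fin 2), rk N (vO (E := QN N) t h i) =
    if (t i).val = max (t 0).val (t 1).val then 4 * max (t 0).val (t 1).val - 1
      else 4 * max (t 0).val (t 1).val - 3 := fun _ _ _ => rfl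
  have rF : ∀ (t : Fin 2 → Fin N) (h), rk N (vF (E := QN N) t h) =
    4 * max (t 0).val (t 1).val - 2 := fun _ _ => rfl
  have up1 : ∀ (t : Fin 2 → Fin N) (i : Fin 2), (t i).val ≤ max (t 0).val (t 1).val := by
    intro t i
    fin_cases i <;> simp
  intro v a b ha hb hra hrb
  rcases IncV_cases v with ⟨x, rfl⟩ | ⟨t, h, i, rfl⟩ | ⟨t, h, rfl⟩
  · obtain ⟨t, ht, i, hti, rfl⟩ := adj_vE ha
    obtain ⟨s, hs, j, hsj, rfl⟩ := adj_vE hb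
    change Fin 2 → Fin N at t s
    change Fin N at x
    have ht' : edg (t 0).val (t 1).val := ht
    have hs' : edg (s 0).val (s 1).val := hs
    have mt := (edg_max ht').1
    have ms := (edg_max hs').1
    rw [rO, rE] at hra hrb
    have ut := up1 t i
    have us := up1 s j
    rw [hti] at hra ut
    rw [hsj] at hrb us
    have et : x.val = max (t 0).val (t 1).val := by
      by_contra hc; rw [if_neg hc] at hra; omega
    have es : x.val = max (s 0).val (s 1).val := by
      by_contra hc; rw [if_neg hc] at hrb; omega
    have e := QN_fact_unique ht' hs' (et.symm.trans es)
    subst e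
    have hij : i = j := by
      have hn := edg_ne ht'
      have e : (t i).val = (t j).val := by rw [hti, hsj]
      fin_cases i <;> fin_cases j <;> first | rfl | (exfalso; simp at e hn; omega)
    subst hij
    rfl
  · change Fin 2 → Fin N at t
    have ht' : edg (t 0).val (t 1).val := h
    have mt := (edg_max ht').1
    have ut := up1 t i
    have fin : ∀ c, (incGraph (QN N)).Adj (vO t h i) c → rk N c ≤ rk N (vO t h i) →
        c = if (t i).val = max (t 0).val (t 1).val then vF t h else vE (t i) := by
      intro c hc hr
      rcases adj_vO hc with rfl | rfl
      · rw [rO, rE] at hr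
        split_ifs at hr ⊢
        · omega
        · rfl
      · rw [rO, rF] at hr
        split_ifs at hr ⊢
        · rfl
        · omega
    rw [fin a ha hra, fin b hb hrb]
  · change Fin 2 → Fin N at t
    have ht' : edg (t 0).val (t 1).val := h
    have mt := (edg_max ht').1
    have hn := edg_ne ht'
    obtain ⟨i, rfl⟩ := adj_vF ha
    obtain ⟨j, rfl⟩ := adj_vF hb
    rw [rO, rF] at hra hrb
    have ei : (t i).val ≠ max (t 0).val (t 1).val := by
      intro hc; rw [if_pos hc] at hra; omega
    have ej : (t j).val ≠ max (t 0).val (t 1).val := by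
      intro hc; rw [if_pos hc] at hrb; omega
    have hij : i = j := by
      fin_cases i <;> fin_cases j <;> first | rfl | (exfalso; simp at ei ej; omega)
    rw [hij]

theorem QN_edge {N : ℕ} (x : Fin N) (hx : 1 ≤ x.val) :
    ∃ y : Fin N, y.val = par x.val ∧ (BRel (QN N) x y ∨ BRel (QN N) y x) := by
  refine ⟨⟨par x.val, (par_lt hx).trans x.2⟩, rfl, ?_⟩
  by_cases h : up x.val
  · exact Or.inr (Or.inl ⟨hx, h, rfl⟩)
  · exact Or.inl (Or.inr ⟨hx, h, rfl⟩)

theorem reach_rel {E : BStruct} {x y : E.dom} (h : BRel E x y) :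
    (incGraph E).Reachable (vE x) (vE y) :=
  (((adjEO _ h 0).reachable.trans (adjOF _ h 0).reachable).trans
        (adjOF _ h 1).symm.reachable).trans (adjEO _ h 1).symm.reachable

theorem QN_connected (N : ℕ) (hN : 0 < N) : IncConnected (QN N) := by
  let z : Fin N := ⟨0, hN⟩
  have hE : ∀ n (hn : n < N), (incGraph (QN N)).Reachable (vE (E := QN N) z)
      (vE (E := QN N) (⟨n, hn⟩ : Fin N)) := by
    intro n
    induction n using Nat.strong_induction_on with
    | _ n ih =>
      intro hn
      rcases Nat.eq_zero_or_pos n with rfl | hp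
      · rfl
      · obtain ⟨y, hy, h⟩ := QN_edge ⟨n, hn⟩ hp
        have hy' : y.val < n := by rw [hy]; exact par_lt hp
        refine (ih y.val hy' y.2).trans ?_
        rcases h with h | h
        · exact (reach_rel h).symm
        · exact reach_rel h
  have hE' : ∀ x : (QN N).dom, (incGraph (QN N)).Reachable (vE (E := QN N) z) (vE x) :=
    fun x => hE (x : Fin N).val (x : Fin N).2
  rw [IncConnected, SimpleGraph.connected_iff_exists_forall_reachable]
  refine ⟨vE (E := QN N) z, fun v => ?_⟩
  rcases IncV_cases v with ⟨x, rfl⟩ | ⟨t, h, i, rfl⟩ | ⟨t, h, rfl⟩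
  · exact hE' x
  · exact (hE' (t i)).trans (adjEO t h i).reachable
  · exact ((hE' (t 0)).trans (adjEO t h 0).reachable).trans (adjOF t h 0).reachable

theorem QN_isCQ (N : ℕ) (hN : 2 ≤ N) : IsCQ (QN N) := by
  intro x
  change Fin N at x
  have : ∃ y : Fin N, BRel (QN N) x y ∨ BRel (QN N) y x := by
    rcases Nat.eq_zero_or_pos x.val with h | h
    · refine ⟨⟨1, hN⟩, Or.inr (Or.inr ⟨le_rfl, ?_, ?_⟩)⟩
      · simp [up]
      · simpa [par] using h
    · obtain ⟨y, -, hy⟩ := QN_edge x h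
      exact ⟨y, hy⟩
  obtain ⟨y, h | h⟩ := this
  · exact ⟨(), _, h, (0 : Fin 2), rfl⟩
  · exact ⟨(), _, h, (1 : Fin 2), rfl⟩

theorem QN_no_hom {E : BStruct} (hE : Acyclic E) (hT : ¬ HomTo Tq E) (m : ℕ) (hm : 1 ≤ m)
    (hc : Nat.card E.dom < 4 * m) : ¬ HomTo (QN (8 * m)) E := by
  rintro ⟨h, hh⟩
  let g : ℕ → E.dom := fun n => h (⟨n % (8 * m), Nat.mod_lt _ (by omega)⟩ : Fin (8 * m))
  have hg : ∀ x y, x < 8 * m → y < 8 * m → edg x y → BRel E (g x) (g y) := by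
    intro x y hx hy hxy
    refine rel_of_isHom hh ?_
    refine (rel_QN _ _).2 ?_
    simpa [Nat.mod_eq_of_lt hx, Nat.mod_eq_of_lt hy] using hxy
  have cb : ∀ i < m, BRel E (g (8 * i + 1)) (g (8 * i)) := fun i hi =>
    hg _ _ (by omega) (by omega) (by unfold edg up par; split_ifs <;> omega)
  have ab : ∀ i < m, BRel E (g (8 * i + 2)) (g (8 * i + 1)) := fun i hi =>
    hg _ _ (by omega) (by omega) (by unfold edg up par; split_ifs <;> omega)
  have ad : ∀ i < m, BRel E (g (8 * i + 2)) (g (8 * i + 3)) := fun i hi =>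
    hg _ _ (by omega) (by omega) (by unfold edg up par; split_ifs <;> omega)
  have e1 : ∀ i < m, BRel E (g (8 * i + 4)) (g (8 * i + 1)) := fun i hi =>
    hg _ _ (by omega) (by omega) (by unfold edg up par; split_ifs <;> omega)
  have e0 : ∀ i < m, BRel E (g (8 * i + 5)) (g (8 * i + 4)) := fun i hi =>
    hg _ _ (by omega) (by omega) (by unfold edg up par; split_ifs <;> omega)
  have f2 : ∀ i < m, BRel E (g (8 * i + 3)) (g (8 * i + 6)) := fun i hi =>
    hg _ _ (by omega) (by omega) (by unfold edg up par; split_ifs <;> omega)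
  have f3 : ∀ i < m, BRel E (g (8 * i + 6)) (g (8 * i + 7)) := fun i hi =>
    hg _ _ (by omega) (by omega) (by unfold edg up par; split_ifs <;> omega)
  have dc : ∀ i, i + 1 < m → BRel E (g (8 * i + 3)) (g (8 * (i + 1))) := fun i hi =>
    hg _ _ (by omega) (by omega) (by unfold edg up par; split_ifs <;> omega)
  have noloop : ∀ x y, BRel E x y → x ≠ y := by
    rintro x _ hx rfl
    exact hT (Tq_hom hx hx hx hx)
  have nca : ∀ i < m, ∀ j < m, g (8 * i) ≠ g (8 * j + 2) := by
    intro i hi j hj e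
    have k := ab j hj
    rw [← e] at k
    exact hT (Tq_hom (e0 i hi) (e1 i hi) (cb i hi) k)
  have nbd : ∀ i < m, ∀ j < m, g (8 * i + 1) ≠ g (8 * j + 3) := by
    intro i hi j hj e
    have k := f2 j hj
    rw [← e] at k
    exact hT (Tq_hom (e0 i hi) (e1 i hi) k (f3 j hj))
  let w : ℕ → E.dom := fun k => g (8 * (k / 4) + k % 4)
  have w0 : ∀ i r, r < 4 → w (4 * i + r) = g (8 * i + r) := by
    intro i r hr
    have h1 : (4 * i + r) / 4 = i := by omega
    have h2 : (4 * i + r) % 4 = r := by omega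
    simp only [w, h1, h2]
  have w4 : ∀ i r, r < 4 → w (4 * i + (4 + r)) = g (8 * (i + 1) + r) := by
    intro i r hr
    rw [← w0 (i + 1) r hr]; congr 1; ring
  obtain ⟨p, hp, hl, -⟩ := exists_path (gai_acyclic hE) w (4 * m - 1) (by
      intro k hk
      obtain ⟨i, r, hr, rfl⟩ : ∃ i r, r < 4 ∧ k = 4 * i + r :=
        ⟨k / 4, k % 4, by omega, by omega⟩
      have hi : i < m := by omega
      interval_cases r
      · rw [add_assoc, w0 i 0 (by omega), w0 i (0 + 1) (by omega)]
        exact ⟨(noloop _ _ (cb i hi)).symm, Or.inr (cb i hi)⟩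
      · rw [add_assoc, w0 i 1 (by omega), w0 i (1 + 1) (by omega)]
        exact ⟨(noloop _ _ (ab i hi)).symm, Or.inr (ab i hi)⟩
      · rw [add_assoc, w0 i 2 (by omega), w0 i (2 + 1) (by omega)]
        exact ⟨noloop _ _ (ad i hi), Or.inl (ad i hi)⟩
      · have hi' : i + 1 < m := by omega
        rw [add_assoc, w0 i 3 (by omega), w4 i 0 (by omega)]
        exact ⟨noloop _ _ (dc i hi'), Or.inl (dc i hi')⟩)
    (by
      intro k hk
      obtain ⟨i, r, hr, rfl⟩ : ∃ i r, r < 4 ∧ k = 4 * i + r :=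
        ⟨k / 4, k % 4, by omega, by omega⟩
      have hi : i < m := by omega
      interval_cases r
      · rw [add_assoc, w0 i 0 (by omega), w0 i (0 + 2) (by omega)]
        exact nca i hi i hi
      · rw [add_assoc, w0 i 1 (by omega), w0 i (1 + 2) (by omega)]
        exact nbd i hi i hi
      · have hi' : i + 1 < m := by omega
        rw [add_assoc, w0 i 2 (by omega), w4 i 0 (by omega)]
        exact (nca _ hi' i hi).symm
      · have hi' : i + 1 < m := by omega
        rw [add_assoc, w0 i 3 (by omega), w4 i 1 (by omega)]
        exact (nbd _ hi' i hi).symm) (4 * m - 1) le_rfl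
  have := Fintype.ofFinite E.dom
  have hlt := hp.length_lt
  rw [← Nat.card_eq_fintype_card] at hlt
  omega

/-- The Boolean query `T` is not uniquely characterized, w.r.t. the class of Boolean
acyclic connected CQs, by any finite set of acyclic positive and negative examples. -/
theorem stmt_14 :
    ¬ ∃ Ep Em : Set (PStruct Unit (fun _ => 2) 0),
        Ep.Finite ∧ Em.Finite ∧ (∀ E ∈ Ep ∪ Em, Acyclic E) ∧
        UniquelyCharacterizes Ep Em Tq
          {Q : PStruct Unit (fun _ => 2) 0 | IsCQ Q ∧ Acyclic Q ∧ IncConnected Q} := by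
  rintro ⟨Ep, Em, -, hfin, hac, ⟨hpos, hneg⟩, huniq⟩
  obtain ⟨M, hM⟩ := (hfin.image (fun E => Nat.card E.dom)).bddAbove
  have hM' : ∀ E ∈ Em, Nat.card E.dom ≤ M := fun E hE => hM ⟨E, hE, rfl⟩
  refine QN_nhom (8 * (M + 1)) (huniq (QN (8 * (M + 1)))
    ⟨QN_isCQ _ (by omega), QN_acyclic _, QN_connected _ (by omega)⟩ ⟨?_, ?_⟩).1
  · intro E hE
    obtain ⟨f, hf⟩ := QN_hom (8 * (M + 1))
    obtain ⟨g, hg⟩ := hpos E hE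
    exact ⟨g ∘ f, isHom_of_rel fun x y h => rel_of_isHom hg (rel_of_isHom hf h)⟩
  · intro E hE
    have := hM' E hE
    exact QN_no_hom (hac E (Or.inr hE)) (hneg E hE) (M + 1) (by omega) (by omega)
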